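/- arXiv:2409.18801 — 6 statements merged into one kernel-verified Lean document; each statement's English description precedes it below -/
import Mathlib

section
/- Let ℓ > 0 and let u : [0,ℓ] → ℝ be continuous with u(0) = u(ℓ) = 0, differentiable on (0,ℓ) with derivative u' square integrable on (0,ℓ). Then for every x ∈ [0,ℓ] one has u(x)² ≤ (ℓ/4) ∫_0^ℓ u'(t)² dt; in particular (sup_{x∈[0,ℓ]} |u(x)|)² ≤ (ℓ/4) ∫_0^ℓ u'(t)² dt. -/
open MeasureTheory

lemma agmon_aux {a b : ℝ} (hab : a ≤ b) (u u' : ℝ → ℝ)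
    (hc : ContinuousOn u (Set.Icc a b))
    (hd : ∀ x ∈ Set.Ioo a b, HasDerivAt u (u' x) x)
    (hi : IntervalIntegrable (fun t => (u' t) ^ 2) volume a b) (c : ℝ) :
    2 * c * (u b - u a) ≤ (∫ t in a..b, (u' t) ^ 2) + c ^ 2 * (b - a) := by
  have hi2 : IntervalIntegrable (fun t => (u' t) ^ 2 + c ^ 2) volume a b :=
    hi.add intervalIntegrable_const
  have h := intervalIntegral.sub_le_integral_of_hasDeriv_right_of_le
    (g := fun t => 2 * c * u t) (g' := fun t => 2 * c * u' t)
    (φ := fun t => (u' t) ^ 2 + c ^ 2) hab (continuousOn_const.mul hc)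
    (fun x hx => ((hd x hx).const_mul (2 * c)).hasDerivWithinAt)
    ((intervalIntegrable_iff_integrableOn_Icc_of_le hab).1 hi2)
    (fun x _ => by nlinarith [sq_nonneg (u' x - c)])
  rw [intervalIntegral.integral_add hi intervalIntegrable_const,
    intervalIntegral.integral_const, smul_eq_mul] at h
  linarith

/-- Sharp 1D Agmon-type inequality: for `u` continuous on `[0,ℓ]`, vanishing at both
endpoints, differentiable on `(0,ℓ)` with square integrable derivative,
`u(x)² ≤ (ℓ/4) ∫_0^ℓ u'(t)² dt` for every `x ∈ [0,ℓ]`; in particular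
`(sup_{[0,ℓ]} |u|)² ≤ (ℓ/4) ∫_0^ℓ u'(t)² dt`. -/
theorem agmon_interval (ℓ : ℝ) (hℓ : 0 < ℓ) (u u' : ℝ → ℝ)
    (hu_cont : ContinuousOn u (Set.Icc 0 ℓ))
    (hu0 : u 0 = 0) (huℓ : u ℓ = 0)
    (hderiv : ∀ x ∈ Set.Ioo 0 ℓ, HasDerivAt u (u' x) x)
    (hint : IntervalIntegrable (fun t => (u' t) ^ 2) volume 0 ℓ) :
    (∀ x ∈ Set.Icc 0 ℓ, (u x) ^ 2 ≤ (ℓ / 4) * ∫ t in (0:ℝ)..ℓ, (u' t) ^ 2) ∧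
    (⨆ x ∈ Set.Icc (0:ℝ) ℓ, |u x|) ^ 2 ≤ (ℓ / 4) * ∫ t in (0:ℝ)..ℓ, (u' t) ^ 2 := by
  have key : ∀ x ∈ Set.Icc 0 ℓ, (u x) ^ 2 ≤ (ℓ / 4) * ∫ t in (0:ℝ)..ℓ, (u' t) ^ 2 := by
    rintro x ⟨h0, h1⟩
    have i1 : IntervalIntegrable (fun t => (u' t) ^ 2) volume 0 x :=
      hint.mono_set (by rw [Set.uIcc_of_le h0, Set.uIcc_of_le hℓ.le]
                        exact Set.Icc_subset_Icc le_rfl h1)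
    have i2 : IntervalIntegrable (fun t => (u' t) ^ 2) volume x ℓ :=
      hint.mono_set (by rw [Set.uIcc_of_le h1, Set.uIcc_of_le hℓ.le]
                        exact Set.Icc_subset_Icc h0 le_rfl)
    have e1 := agmon_aux h0 u u' (hu_cont.mono (Set.Icc_subset_Icc le_rfl h1))
      (fun y hy => hderiv y ⟨hy.1, hy.2.trans_le h1⟩) i1 (2 * u x / ℓ)
    have e2 := agmon_aux h1 u u' (hu_cont.mono (Set.Icc_subset_Icc h0 le_rfl))
      (fun y hy => hderiv y ⟨h0.trans_lt hy.1, hy.2⟩) i2 (-(2 * u x / ℓ))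
    rw [hu0] at e1
    rw [huℓ] at e2
    rw [← intervalIntegral.integral_add_adjacent_intervals i1 i2]
    set I1 := ∫ t in (0:ℝ)..x, (u' t) ^ 2
    set I2 := ∫ t in x..ℓ, (u' t) ^ 2
    obtain ⟨v, hv⟩ : ∃ v, v = 2 * u x / ℓ := ⟨_, rfl⟩
    have hux : u x = v * ℓ / 2 := by rw [hv]; field_simp
    rw [← hv, hux] at e1 e2
    rw [hux]
    have e3 : v ^ 2 * ℓ ≤ I1 + I2 := by nlinarith
    nlinarith [mul_le_mul_of_nonneg_left e3 hℓ.le]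
  refine ⟨key, ?_⟩
  have hI := (sq_nonneg (u 0)).trans (key 0 ⟨le_rfl, hℓ.le⟩)
  set M := (ℓ / 4) * ∫ t in (0:ℝ)..ℓ, (u' t) ^ 2
  have hle : (⨆ x ∈ Set.Icc (0:ℝ) ℓ, |u x|) ≤ √M :=
    Real.iSup_le (fun x => Real.iSup_le (fun hx => Real.abs_le_sqrt (key x hx))
      (Real.sqrt_nonneg _)) (Real.sqrt_nonneg _)
  have hnn : 0 ≤ (⨆ x ∈ Set.Icc (0:ℝ) ℓ, |u x|) :=
    Real.iSup_nonneg fun x => Real.iSup_nonneg fun _ => abs_nonneg _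
  calc _ ≤ √M ^ 2 := pow_le_pow_left₀ hnn hle 2
    _ = M := Real.sq_sqrt hI
end

section
/- Let ℓ > 0 and define the hat function u : [0,ℓ] → ℝ by u(x) = x for 0 ≤ x ≤ ℓ/2 and u(x) = ℓ − x for ℓ/2 ≤ x ≤ ℓ. Then sup_{x∈[0,ℓ]} |u(x)| = ℓ/2 and ∫_0^ℓ u'(t)² dt = ℓ (the derivative being defined off the finite set {ℓ/2}), so that equality (sup |u|)² = (ℓ/4)∫_0^ℓ u'(t)² dt holds; hence the constant ℓ/4 in the inequality ‖u‖_{L_∞}² ≤ (ℓ/4)‖u'‖_{L_2}² for functions vanishing at 0 and ℓ is sharp. -/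
open MeasureTheory

/-- The hat function `u(x) = x` on `[0,ℓ/2]`, `u(x) = ℓ−x` on `[ℓ/2,ℓ]` satisfies
`sup_{[0,ℓ]} |u| = ℓ/2` and `∫_0^ℓ u'(t)² dt = ℓ` (the derivative being defined off the
single point `ℓ/2`), hence gives equality `(sup |u|)² = (ℓ/4) ∫_0^ℓ u'(t)² dt`; so the
constant `ℓ/4` in the inequality `‖u‖_∞² ≤ (ℓ/4)‖u'‖₂²` is sharp. -/
theorem hat_function_extremal (ℓ : ℝ) (hℓ : 0 < ℓ) (u u' : ℝ → ℝ)
    (hu : ∀ x, u x = if x ≤ ℓ / 2 then x else ℓ - x)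
    (hderiv : ∀ x ∈ Set.Ioo 0 ℓ, x ≠ ℓ / 2 → HasDerivAt u (u' x) x) :
    (⨆ x ∈ Set.Icc (0:ℝ) ℓ, |u x|) = ℓ / 2 ∧
    (∫ t in (0:ℝ)..ℓ, (u' t) ^ 2) = ℓ ∧
    (⨆ x ∈ Set.Icc (0:ℝ) ℓ, |u x|) ^ 2 = (ℓ / 4) * ∫ t in (0:ℝ)..ℓ, (u' t) ^ 2 := by
  have hinner : ∀ x, (⨆ (_ : x ∈ Set.Icc (0:ℝ) ℓ), |u x|) ≤ ℓ / 2 := by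
    intro x
    refine Real.iSup_le (fun hx => ?_) (by linarith)
    obtain ⟨h0, h1⟩ := hx
    rw [hu x, abs_le]
    split_ifs with h <;> constructor <;> linarith
  have hsup : (⨆ x ∈ Set.Icc (0:ℝ) ℓ, |u x|) = ℓ / 2 := by
    apply le_antisymm
    · exact Real.iSup_le hinner (by linarith)
    · have hb : BddAbove (Set.range fun x => ⨆ (_ : x ∈ Set.Icc (0:ℝ) ℓ), |u x|) := by
        refine ⟨ℓ / 2, ?_⟩
        rintro _ ⟨x, rfl⟩
        exact hinner x
      have h := le_ciSup hb (ℓ / 2)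
      have hm : ℓ / 2 ∈ Set.Icc (0:ℝ) ℓ := ⟨by linarith, by linarith⟩
      have e : (⨆ (_ : ℓ / 2 ∈ Set.Icc (0:ℝ) ℓ), |u (ℓ / 2)|) = ℓ / 2 := by
        rw [ciSup_pos hm, hu, if_pos le_rfl, abs_of_pos (by linarith)]
      simp only [e] at h
      exact h
  have hsq : ∀ x ∈ Set.Ioo 0 ℓ, x ≠ ℓ / 2 → (u' x) ^ 2 = 1 := by
    intro x hx hne
    have hd := hderiv x hx hne
    rcases lt_or_gt_of_ne hne with h | h
    · have h2 : HasDerivAt u 1 x := by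
        refine (hasDerivAt_id x).congr_of_eventuallyEq ?_
        filter_upwards [Iio_mem_nhds h] with y hy
        rw [hu, if_pos (le_of_lt hy)]
        rfl
      rw [hd.unique h2]; norm_num
    · have h2 : HasDerivAt u (-1) x := by
        refine ((hasDerivAt_id x).const_sub ℓ).congr_of_eventuallyEq ?_
        filter_upwards [Ioi_mem_nhds h] with y hy
        rw [hu, if_neg (not_le.mpr hy)]
        rfl
      rw [hd.unique h2]; norm_num
  have hint : (∫ t in (0:ℝ)..ℓ, (u' t) ^ 2) = ℓ := by
    have : (∫ t in (0:ℝ)..ℓ, (u' t) ^ 2) = ∫ t in (0:ℝ)..ℓ, (1:ℝ) := by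
      apply intervalIntegral.integral_congr_ae
      filter_upwards [Measure.ae_ne volume (ℓ / 2), Measure.ae_ne volume ℓ] with x h1 h2 hx
      rw [Set.uIoc_of_le hℓ.le] at hx
      exact hsq x ⟨hx.1, lt_of_le_of_ne hx.2 h2⟩ h1
    rw [this]; simp
  refine ⟨hsup, hint, ?_⟩
  rw [hsup, hint]; ring
end

section
/- Let ℓ > 0 and let φ_1,…,φ_n : [0,ℓ] → ℝ be continuous functions with φ_j(0) = φ_j(ℓ) = 0, differentiable on (0,ℓ) with square integrable derivatives, such that the family of derivatives {φ_1',…,φ_n'} is suborthonormal in L_2(0,ℓ), i.e. ∑_{i,j=1}^n ξ_i ξ_j ∫_0^ℓ φ_i'(t) φ_j'(t) dt ≤ ∑_{j=1}^n ξ_j² for all ξ ∈ ℝ^n. Then for every x ∈ [0,ℓ] one has ρ(x) := ∑_{j=1}^n φ_j(x)² ≤ ℓ/4, and this constant is sharp. -/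
open MeasureTheory
open scoped BigOperators

/-- A family `φ_1, …, φ_n` of functions on `[0,ℓ]`, vanishing at both endpoints,
differentiable on `(0,ℓ)`, whose derivatives form a suborthonormal family in `L_2(0,ℓ)`. -/
def SuborthGradFamily (ℓ : ℝ) (n : ℕ) (φ φ' : Fin n → ℝ → ℝ) : Prop :=
  (∀ j, ContinuousOn (φ j) (Set.Icc 0 ℓ)) ∧
  (∀ j, φ j 0 = 0) ∧ (∀ j, φ j ℓ = 0) ∧
  (∀ j, ∀ x ∈ Set.Ioo 0 ℓ, HasDerivAt (φ j) (φ' j x) x) ∧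
  (∀ i j, IntervalIntegrable (fun t => φ' i t * φ' j t) volume 0 ℓ) ∧
  (∀ ξ : Fin n → ℝ,
    ∑ i, ∑ j, ξ i * ξ j * ∫ t in (0:ℝ)..ℓ, φ' i t * φ' j t ≤ ∑ i, (ξ i) ^ 2)

lemma aux_half (a b k : ℝ) (hab : a ≤ b) (u u' : ℝ → ℝ) (hc : ContinuousOn u (Set.Icc a b))
    (hd : ∀ x ∈ Set.Ioo a b, HasDerivAt u (u' x) x)
    (hi : IntervalIntegrable (fun t => u' t * u' t) volume a b) :
    2 * k * (u b - u a) - k ^ 2 * (b - a) ≤ ∫ t in a..b, u' t * u' t := by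
  have h := intervalIntegral.sub_le_integral_of_hasDeriv_right_of_le (a := a) (b := b)
    (g := fun t => 2 * k * u t - k ^ 2 * t) (g' := fun t => 2 * k * u' t - k ^ 2 * 1)
    (φ := fun t => u' t * u' t) hab (by fun_prop)
    (fun x hx => (((hd x hx).const_mul (2 * k)).sub
      ((hasDerivAt_id x).const_mul (k ^ 2))).hasDerivWithinAt)
    ((intervalIntegrable_iff_integrableOn_Icc_of_le hab).1 hi)
    (fun x _ => by nlinarith [sq_nonneg (u' x - k)])
  linarith

lemma aux_sup (ℓ : ℝ) (hℓ : 0 < ℓ) (u u' : ℝ → ℝ) (hc : ContinuousOn u (Set.Icc 0 ℓ))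
    (h0 : u 0 = 0) (h1 : u ℓ = 0)
    (hd : ∀ x ∈ Set.Ioo 0 ℓ, HasDerivAt u (u' x) x)
    (hi : IntervalIntegrable (fun t => u' t * u' t) volume 0 ℓ) (x : ℝ) (hx : x ∈ Set.Icc 0 ℓ) :
    u x ^ 2 ≤ ℓ / 4 * ∫ t in (0:ℝ)..ℓ, u' t * u' t := by
  obtain ⟨hx0, hx1⟩ := hx
  have i1 : IntervalIntegrable (fun t => u' t * u' t) volume 0 x :=
    hi.mono_set (by rw [Set.uIcc_of_le hx0, Set.uIcc_of_le hℓ.le]; exact Set.Icc_subset_Icc_right hx1)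
  have i2 : IntervalIntegrable (fun t => u' t * u' t) volume x ℓ :=
    hi.mono_set (by rw [Set.uIcc_of_le hx1, Set.uIcc_of_le hℓ.le]; exact Set.Icc_subset_Icc_left hx0)
  have a1 := aux_half 0 x (2 * u x / ℓ) hx0 u u' (hc.mono (Set.Icc_subset_Icc_right hx1))
    (fun y hy => hd y ⟨hy.1, hy.2.trans_le hx1⟩) i1
  have a2 := aux_half x ℓ (-(2 * u x / ℓ)) hx1 u u' (hc.mono (Set.Icc_subset_Icc_left hx0))
    (fun y hy => hd y ⟨hx0.trans_lt hy.1, hy.2⟩) i2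
  rw [← intervalIntegral.integral_add_adjacent_intervals i1 i2]
  rw [h0] at a1
  rw [h1] at a2
  have e := mul_le_mul_of_nonneg_left (add_le_add a1 a2) (by positivity : 0 ≤ ℓ / 4)
  refine le_trans (le_of_eq ?_) e
  field_simp
  ring

lemma aux_upper (ℓ : ℝ) (hℓ : 0 < ℓ) (n : ℕ) (φ φ' : Fin n → ℝ → ℝ)
    (h : SuborthGradFamily ℓ n φ φ') (x : ℝ) (hx : x ∈ Set.Icc 0 ℓ) :
    ∑ j, (φ j x) ^ 2 ≤ ℓ / 4 := by
  obtain ⟨hc, h0, h1, hd, hi, hs⟩ := h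
  have key : ∀ t, (∑ j, φ j x * φ' j t) * (∑ j, φ j x * φ' j t)
      = ∑ i, ∑ j, φ i x * φ j x * (φ' i t * φ' j t) := by
    intro t
    rw [Finset.sum_mul_sum]
    refine Finset.sum_congr rfl fun i _ => Finset.sum_congr rfl fun j _ => by ring
  have hii : ∀ i j, IntervalIntegrable (fun t => φ i x * φ j x * (φ' i t * φ' j t)) volume 0 ℓ :=
    fun i j => (hi i j).const_mul _
  have hij : ∀ i, IntervalIntegrable (fun t => ∑ j, φ i x * φ j x * (φ' i t * φ' j t)) volume 0 ℓ := by
    intro i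
    have := IntervalIntegrable.sum Finset.univ (fun j _ => hii i j)
    simpa only [Finset.sum_fn] using this
  have hI : IntervalIntegrable (fun t => ∑ i, ∑ j, φ i x * φ j x * (φ' i t * φ' j t)) volume 0 ℓ := by
    have := IntervalIntegrable.sum Finset.univ (fun i _ => hij i)
    simpa only [Finset.sum_fn] using this
  have a := aux_sup ℓ hℓ (fun t => ∑ j, φ j x * φ j t) (fun t => ∑ j, φ j x * φ' j t)
    (continuousOn_finsetSum _ fun j _ => (hc j).const_smul (φ j x))
    (by simp [h0]) (by simp [h1])
    (fun y hy => HasDerivAt.fun_sum fun j _ => (hd j y hy).const_mul _)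
    (by simpa only [key] using hI) x hx
  simp only [key] at a
  rw [intervalIntegral.integral_finsetSum (fun i _ => hij i)] at a
  simp_rw [fun i => intervalIntegral.integral_finsetSum (μ := volume) (a := 0) (b := ℓ)
    (s := Finset.univ) (fun j _ => hii i j), intervalIntegral.integral_const_mul] at a
  have b := hs (fun j => φ j x)
  simp only [← pow_two] at a b
  set r := ∑ j, (φ j x) ^ 2 with hr
  have hr0 : 0 ≤ r := Finset.sum_nonneg fun j _ => sq_nonneg _
  have c : r ^ 2 ≤ ℓ / 4 * r := a.trans (mul_le_mul_of_nonneg_left b (by positivity))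
  by_contra hcon
  push Not at hcon
  nlinarith

lemma aux_sharp (ℓ : ℝ) (hℓ : 0 < ℓ) (c : ℝ) (hc : c < ℓ / 4) :
    ∃ (n : ℕ) (φ φ' : Fin n → ℝ → ℝ),
      SuborthGradFamily ℓ n φ φ' ∧ ∃ x ∈ Set.Icc (0:ℝ) ℓ, c < ∑ j, (φ j x) ^ 2 := by
  obtain ⟨ε, hε, hεc⟩ : ∃ ε : ℝ, 0 < ε ∧ c < ((√((ℓ/2)^2 + ε) - √ε) / √ℓ) ^ 2 := by
    have hcont : Continuous fun ε : ℝ => ((√((ℓ/2)^2 + ε) - √ε) / √ℓ) ^ 2 := by fun_prop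
    have h0 : c < ((√((ℓ/2)^2 + 0) - √0) / √ℓ) ^ 2 := by
      rw [add_zero, Real.sqrt_sq (by positivity), Real.sqrt_zero, sub_zero, div_pow,
        Real.sq_sqrt hℓ.le]
      refine hc.trans_eq ?_
      field_simp
      norm_num
    have h1 := (hcont.continuousAt (x := 0)).eventually (lt_mem_nhds h0)
    have h2 := (h1.filter_mono (nhdsWithin_le_nhds (s := Set.Ioi 0))).and self_mem_nhdsWithin
    obtain ⟨ε, h3, h4⟩ := h2.exists
    exact ⟨ε, h4, h3⟩
  have hp : ∀ t : ℝ, 0 < (t - ℓ/2)^2 + ε := fun t => by positivity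
  have hsp : ∀ t : ℝ, √((t - ℓ/2)^2 + ε) ≠ 0 := fun t => (Real.sqrt_pos.2 (hp t)).ne'
  have hs : √ℓ ≠ 0 := (Real.sqrt_pos.2 hℓ).ne'
  have hcont : Continuous fun t : ℝ => -((t - ℓ/2) / √((t - ℓ/2)^2 + ε)) / √ℓ := by
    fun_prop (disch := exact hsp _)
  refine ⟨1, fun _ t => (√((ℓ/2)^2 + ε) - √((t - ℓ/2)^2 + ε)) / √ℓ,
    fun _ t => -((t - ℓ/2) / √((t - ℓ/2)^2 + ε)) / √ℓ, ⟨?_, ?_, ?_, ?_, ?_, ?_⟩, ℓ/2,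
    ⟨by positivity, by linarith⟩, ?_⟩
  · intro _
    exact Continuous.continuousOn (by fun_prop)
  · intro _
    simp
  · intro _
    have : ℓ - ℓ/2 = ℓ/2 := by ring
    simp [this]
  · intro _ x _
    have h1 : HasDerivAt (fun t : ℝ => (t - ℓ/2)^2 + ε) (2 * (x - ℓ/2)) x := by
      have := (((hasDerivAt_id x).sub_const (ℓ/2)).pow 2).add_const ε
      simpa using this
    have h2 := ((h1.sqrt (hp x).ne').const_sub (√((ℓ/2)^2 + ε))).div_const (√ℓ)
    rw [mul_div_mul_left _ _ two_ne_zero] at h2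
    exact h2
  · intro _ _
    exact (hcont.mul hcont).intervalIntegrable _ _
  · intro ξ
    simp only [Finset.univ_unique, Finset.sum_singleton]
    have hI : ∫ t in (0:ℝ)..ℓ, (-((t - ℓ/2) / √((t - ℓ/2)^2 + ε)) / √ℓ) *
        (-((t - ℓ/2) / √((t - ℓ/2)^2 + ε)) / √ℓ) ≤ ∫ t in (0:ℝ)..ℓ, 1 / ℓ := by
      refine intervalIntegral.integral_mono_on hℓ.le ((hcont.mul hcont).intervalIntegrable _ _)
        (by simp) fun t _ => ?_
      rw [← pow_two, div_pow, neg_sq, div_pow, Real.sq_sqrt (hp t).le, Real.sq_sqrt hℓ.le]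
      refine div_le_div_of_nonneg_right ?_ hℓ.le
      rw [div_le_one (hp t)]
      linarith
    have hJ : ∫ t in (0:ℝ)..ℓ, 1 / ℓ = 1 := by
      simp [hℓ.ne']
    rw [hJ] at hI
    have := mul_le_mul_of_nonneg_left hI (mul_self_nonneg (ξ default))
    rw [pow_two]
    linarith
  · simpa using hεc

/-- For any family with suborthonormal gradients on `(0,ℓ)` one has
`ρ(x) = ∑_j φ_j(x)² ≤ ℓ/4` for every `x ∈ [0,ℓ]`, and the constant `ℓ/4` is sharp. -/
theorem rho_bound_dim_one (ℓ : ℝ) (hℓ : 0 < ℓ) :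
    (∀ (n : ℕ) (φ φ' : Fin n → ℝ → ℝ), SuborthGradFamily ℓ n φ φ' →
      ∀ x ∈ Set.Icc 0 ℓ, ∑ j, (φ j x) ^ 2 ≤ ℓ / 4) ∧
    (∀ c : ℝ, c < ℓ / 4 → ∃ (n : ℕ) (φ φ' : Fin n → ℝ → ℝ),
      SuborthGradFamily ℓ n φ φ' ∧ ∃ x ∈ Set.Icc (0:ℝ) ℓ, c < ∑ j, (φ j x) ^ 2) := by
  exact ⟨fun n φ φ' h x hx => aux_upper ℓ hℓ n φ φ' h x hx, fun c hc => aux_sharp ℓ hℓ c hc⟩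
end

section
/- Let ℓ > 0, N ≥ 1, and let φ_1,…,φ_n : [0,ℓ] → ℝ^N be continuous vector functions with φ_j(0) = φ_j(ℓ) = 0, each component differentiable on (0,ℓ) with square integrable derivative, such that the family of derivatives {φ_1',…,φ_n'} is suborthonormal in the vector space L_2(0,ℓ; ℝ^N), i.e. ∑_{i,j=1}^n ξ_i ξ_j ∑_{k=1}^N ∫_0^ℓ (φ_i^k)'(t)(φ_j^k)'(t) dt ≤ ∑_{j=1}^n ξ_j² for all ξ ∈ ℝ^n. Then for every x ∈ [0,ℓ] one has ρ(x) := ∑_{j=1}^n |φ_j(x)|² ≤ Nℓ/4, where |·| is the Euclidean norm in ℝ^N. -/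
open MeasureTheory
open scoped BigOperators

lemma int_of_sq (a b : ℝ) (hab : a ≤ b) (g g' : ℝ → ℝ)
    (hd : ∀ x ∈ Set.Ioo a b, HasDerivAt g (g' x) x)
    (hi : IntervalIntegrable (fun t => g' t ^ 2) volume a b) :
    IntervalIntegrable g' volume a b := by
  rw [intervalIntegrable_iff_integrableOn_Ioo_of_le hab] at *
  have hm : AEStronglyMeasurable g' (volume.restrict (Set.Ioo a b)) := by
    refine (measurable_deriv g).aestronglyMeasurable.congr ?_
    filter_upwards [ae_restrict_mem measurableSet_Ioo] with x hx
    exact (hd x hx).deriv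
  have h1 : IntegrableOn (fun t => 1 + g' t ^ 2) (Set.Ioo a b) volume := by
    refine Integrable.add ?_ hi
    exact integrableOn_const (by simp) (by simp)
  refine Integrable.mono' h1 hm ?_
  filter_upwards with x
  rw [Real.norm_eq_abs, abs_le]
  constructor <;> nlinarith [sq_nonneg (g' x - 1), sq_nonneg (g' x + 1)]

lemma half_bound (a b c : ℝ) (hab : a ≤ b) (g g' : ℝ → ℝ)
    (hc : ContinuousOn g (Set.Icc a b))
    (hd : ∀ x ∈ Set.Ioo a b, HasDerivAt g (g' x) x)
    (hi : IntervalIntegrable (fun t => g' t ^ 2) volume a b) :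
    2 * c * (g b - g a) - c ^ 2 * (b - a) ≤ ∫ t in a..b, g' t ^ 2 := by
  have h1 := int_of_sq a b hab g g' hd hi
  have h2 := intervalIntegral.integral_eq_sub_of_hasDerivAt_of_le hab hc hd h1
  have h3 : ∫ t in a..b, (2 * c * g' t - c ^ 2) = 2 * c * (g b - g a) - c ^ 2 * (b - a) := by
    rw [intervalIntegral.integral_sub (h1.const_mul _) (by simp),
      intervalIntegral.integral_const_mul, h2, intervalIntegral.integral_const, smul_eq_mul]
    ring
  rw [← h3]
  refine intervalIntegral.integral_mono_on hab ((h1.const_mul _).sub (by simp)) hi ?_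
  intro x _
  nlinarith [sq_nonneg (g' x - c)]

lemma full_bound (l x : ℝ) (hl : 0 < l) (hx : x ∈ Set.Icc 0 l) (g g' : ℝ → ℝ)
    (hc : ContinuousOn g (Set.Icc 0 l)) (h0 : g 0 = 0) (h1 : g l = 0)
    (hd : ∀ x ∈ Set.Ioo 0 l, HasDerivAt g (g' x) x)
    (hi : IntervalIntegrable (fun t => g' t ^ 2) volume 0 l) :
    4 * g x ^ 2 / l ≤ ∫ t in (0:ℝ)..l, g' t ^ 2 := by
  obtain ⟨hx0, hx1⟩ := hx
  have i1 : IntervalIntegrable (fun t => g' t ^ 2) volume 0 x := by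
    refine hi.mono_set ?_
    rw [Set.uIcc_of_le hx0, Set.uIcc_of_le hl.le]
    exact Set.Icc_subset_Icc_right hx1
  have i2 : IntervalIntegrable (fun t => g' t ^ 2) volume x l := by
    refine hi.mono_set ?_
    rw [Set.uIcc_of_le hx1, Set.uIcc_of_le hl.le]
    exact Set.Icc_subset_Icc_left hx0
  have a1 := half_bound 0 x (2 * g x / l) hx0 g g' (hc.mono (Set.Icc_subset_Icc_right hx1))
    (fun y hy => hd y ⟨hy.1, hy.2.trans_le hx1⟩) i1
  have a2 := half_bound x l (-(2 * g x / l)) hx1 g g' (hc.mono (Set.Icc_subset_Icc_left hx0))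
    (fun y hy => hd y ⟨hx0.trans_lt hy.1, hy.2⟩) i2
  rw [← intervalIntegral.integral_add_adjacent_intervals i1 i2]
  refine le_trans (le_of_eq ?_) (add_le_add a1 a2)
  rw [h0, h1]
  field_simp
  ring

/-- Vector case: if `φ_1, …, φ_n : [0,ℓ] → ℝ^N` vanish at both endpoints, are componentwise
differentiable on `(0,ℓ)`, and their derivatives form a suborthonormal family in
`L_2(0,ℓ;ℝ^N)`, then `ρ(x) = ∑_j |φ_j(x)|² ≤ Nℓ/4` for every `x ∈ [0,ℓ]`. -/
theorem rho_bound_dim_one_vector (ℓ : ℝ) (hℓ : 0 < ℓ) (N : ℕ) (hN : 1 ≤ N)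
    {n : ℕ} (φ φ' : Fin n → ℝ → Fin N → ℝ)
    (hcont : ∀ j k, ContinuousOn (fun t => φ j t k) (Set.Icc 0 ℓ))
    (h0 : ∀ j k, φ j 0 k = 0) (hbdry : ∀ j k, φ j ℓ k = 0)
    (hderiv : ∀ j k, ∀ x ∈ Set.Ioo 0 ℓ, HasDerivAt (fun t => φ j t k) (φ' j x k) x)
    (hint : ∀ i j k, IntervalIntegrable (fun t => φ' i t k * φ' j t k) volume 0 ℓ)
    (hsub : ∀ ξ : Fin n → ℝ,
      ∑ i, ∑ j, ξ i * ξ j * ∑ k, ∫ t in (0:ℝ)..ℓ, φ' i t k * φ' j t k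
        ≤ ∑ i, (ξ i) ^ 2) :
    ∀ x ∈ Set.Icc 0 ℓ, ∑ j, ∑ k, (φ j x k) ^ 2 ≤ N * ℓ / 4 := by
  intro x hx
  have key : ∀ k, ∑ j, (φ j x k) ^ 2 ≤ ℓ / 4 := by
    intro k
    set ξ : Fin n → ℝ := fun j => φ j x k with hξ
    have hexp : ∀ k' t, (∑ j, ξ j * φ' j t k') ^ 2
        = ∑ i, ∑ j, ξ i * ξ j * (φ' i t k' * φ' j t k') := by
      intro k' t
      rw [sq, Finset.sum_mul_sum]
      refine Finset.sum_congr rfl fun i _ => Finset.sum_congr rfl fun j _ => by ring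
    have hii : ∀ k' i, IntervalIntegrable
        (fun t => ∑ j, ξ i * ξ j * (φ' i t k' * φ' j t k')) volume 0 ℓ := by
      intro k' i
      have := IntervalIntegrable.sum (μ := volume) (a := 0) (b := ℓ) Finset.univ
        (f := fun j t => ξ i * ξ j * (φ' i t k' * φ' j t k'))
        (fun j _ => (hint i j k').const_mul _)
      simpa [Finset.sum_fn] using this
    have hI : ∀ k', IntervalIntegrable (fun t => (∑ j, ξ j * φ' j t k') ^ 2) volume 0 ℓ := by
      intro k'
      simp only [hexp]
      have := IntervalIntegrable.sum (μ := volume) (a := 0) (b := ℓ) Finset.univ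
        (f := fun i t => ∑ j, ξ i * ξ j * (φ' i t k' * φ' j t k'))
        (fun i _ => hii k' i)
      simpa [Finset.sum_fn] using this
    have hsum : ∑ k', ∫ t in (0:ℝ)..ℓ, (∑ j, ξ j * φ' j t k') ^ 2 ≤ ∑ i, ξ i ^ 2 := by
      refine le_trans (le_of_eq ?_) (hsub ξ)
      simp only [hexp, Finset.mul_sum]
      have : ∀ k', ∫ t in (0:ℝ)..ℓ, ∑ i, ∑ j, ξ i * ξ j * (φ' i t k' * φ' j t k')
          = ∑ i, ∑ j, ξ i * ξ j * ∫ t in (0:ℝ)..ℓ, φ' i t k' * φ' j t k' := by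
        intro k'
        rw [intervalIntegral.integral_finsetSum (fun i _ => hii k' i)]
        refine Finset.sum_congr rfl fun i _ => ?_
        rw [intervalIntegral.integral_finsetSum (fun j _ => (hint i j k').const_mul _)]
        simp only [intervalIntegral.integral_const_mul]
      simp only [this]
      rw [Finset.sum_comm]
      refine Finset.sum_congr rfl fun i _ => ?_
      rw [Finset.sum_comm]
    have hone : ∫ t in (0:ℝ)..ℓ, (∑ j, ξ j * φ' j t k) ^ 2 ≤ ∑ i, ξ i ^ 2 := by
      refine le_trans ?_ hsum
      exact Finset.single_le_sum
        (f := fun k' => ∫ t in (0:ℝ)..ℓ, (∑ j, ξ j * φ' j t k') ^ 2)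
        (fun k' _ => intervalIntegral.integral_nonneg hℓ.le fun t _ => sq_nonneg _)
        (Finset.mem_univ k)
    have hb := full_bound ℓ x hℓ hx (fun t => ∑ j, ξ j * φ j t k) (fun t => ∑ j, ξ j * φ' j t k)
      (continuousOn_finset_sum _ fun j _ => continuousOn_const.mul (hcont j k))
      (by simp [h0]) (by simp [hbdry])
      (fun y hy => HasDerivAt.fun_sum fun j _ => (hderiv j k y hy).const_mul _) (hI k)
    have hS : ∑ j, ξ j * φ j x k = ∑ j, ξ j ^ 2 :=
      Finset.sum_congr rfl fun j _ => by simp only [hξ]; ring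
    simp only [hS] at hb
    have hb2 := hb.trans hone
    have hnn : 0 ≤ ∑ j, ξ j ^ 2 := Finset.sum_nonneg fun j _ => sq_nonneg _
    change ∑ j, ξ j ^ 2 ≤ ℓ / 4
    generalize ∑ j, ξ j ^ 2 = S at *
    rw [div_le_iff₀ hℓ] at hb2
    rcases hnn.eq_or_lt with h | h
    · linarith
    · nlinarith
  rw [Finset.sum_comm]
  calc _ ≤ ∑ _k : Fin N, ℓ / 4 := Finset.sum_le_sum fun k _ => key k
    _ = _ := by simp; ring
end

section
/- Let a, b ∈ ℝ with b > 0. Then there exist constants C > 0 and ω_0 > 0 such that for every γ ∈ (0,1] and every ω ≥ ω_0 the quadratic equation z² + γ z + (ω² + a + i b) = 0 has a complex root z ∈ ℂ satisfying |Re z − (b/(2ω) − γ/2)| ≤ C ω^{-3}. -/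
/-- Asymptotics of the roots of the characteristic equation `z² + γz + (ω² + a + ib) = 0`:
there are `C > 0` and `ω₀ > 0` such that for every `γ ∈ (0,1]` and `ω ≥ ω₀` the equation
has a root `z` with `|Re z − (b/(2ω) − γ/2)| ≤ C ω^{-3}`. -/
theorem characteristic_root_asymptotics (a b : ℝ) (hb : 0 < b) :
    ∃ C : ℝ, 0 < C ∧ ∃ ω₀ : ℝ, 0 < ω₀ ∧
      ∀ γ : ℝ, 0 < γ → γ ≤ 1 → ∀ ω : ℝ, ω₀ ≤ ω →
        ∃ z : ℂ, z ^ 2 + (γ : ℂ) * z + ((ω : ℂ) ^ 2 + (a : ℂ) + (b : ℂ) * Complex.I) = 0 ∧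
          |z.re - (b / (2 * ω) - γ / 2)| ≤ C / ω ^ 3 := by
  have ha := abs_nonneg a
  have ha1 := neg_abs_le a
  have ha2 := le_abs_self a
  refine ⟨b * (b ^ 2 + |a| + 1), by positivity, 2 * (|a| + 1), by positivity, ?_⟩
  intro γ hγ hγ1 ω hω
  have hω2 : 2 ≤ ω := by linarith
  have hω0 : 0 < ω := by linarith
  have hg : γ ^ 2 ≤ 1 := by nlinarith
  have hg0 : 0 < γ ^ 2 := by positivity
  obtain ⟨P, hP⟩ : ∃ P, P = ω ^ 2 + a - γ ^ 2 / 4 := ⟨_, rfl⟩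
  have hPl : ω ^ 2 / 4 ≤ P := by nlinarith
  obtain ⟨S, hS⟩ : ∃ S, S = √(P ^ 2 + b ^ 2) := ⟨_, rfl⟩
  have hSS : S ^ 2 = P ^ 2 + b ^ 2 := by rw [hS]; exact Real.sq_sqrt (by positivity)
  have hS0 : 0 ≤ S := by rw [hS]; positivity
  have hPS : P ≤ S := by nlinarith
  have hP0 : 0 < P := by nlinarith
  obtain ⟨Y, hY⟩ : ∃ Y, Y = √((P + S) / 2) := ⟨_, rfl⟩
  have hYY : Y ^ 2 = (P + S) / 2 := by rw [hY]; exact Real.sq_sqrt (by positivity)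
  have hY0 : 0 < Y := by rw [hY]; positivity
  have hYl : ω / 2 ≤ Y := by nlinarith
  obtain ⟨x, hx⟩ : ∃ x, x = b / (2 * Y) := ⟨_, rfl⟩
  have hxY : 2 * x * Y = b := by rw [hx]; field_simp
  have hx0 : 0 < x := by rw [hx]; positivity
  have hxb : x ≤ b := by nlinarith
  have hdiff : Y ^ 2 - x ^ 2 = P := by
    have h : (Y ^ 2 - x ^ 2 - P) * (4 * Y ^ 2) = 0 := by
      have e : (Y ^ 2 - x ^ 2 - P) * (4 * Y ^ 2)
        = 4 * (Y ^ 2) ^ 2 - (2 * x * Y) ^ 2 - 4 * P * Y ^ 2 := by ring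
      rw [e, hxY, hYY]; linear_combination hSS
    have := (mul_eq_zero.mp h).resolve_right (by positivity)
    linarith
  refine ⟨⟨x - γ / 2, -Y⟩, ?_, ?_⟩
  · apply Complex.ext
    · simp [pow_two]; nlinarith
    · simp [pow_two]; nlinarith
  · have e : x - γ / 2 - (b / (2 * ω) - γ / 2) = b * (ω ^ 2 - Y ^ 2) / (2 * Y * ω * (ω + Y)) := by
      rw [hx]; field_simp; ring
    show |x - γ / 2 - (b / (2 * ω) - γ / 2)| ≤ _
    rw [e, abs_div, abs_mul, abs_of_pos hb, abs_of_pos (by positivity : 0 < 2 * Y * ω * (ω + Y))]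
    have hK : |ω ^ 2 - Y ^ 2| ≤ b ^ 2 + |a| + 1 := by
      have : x ^ 2 ≤ b ^ 2 := by gcongr
      have := sq_nonneg x
      rw [abs_le]; constructor <;> linarith
    gcongr
    calc ω ^ 3 = (2 * (ω / 2)) * ω * (ω + 0) := by ring
      _ ≤ _ := by gcongr
end

section
/- Let a, b ∈ ℝ with b > 0. Then there exist constants C_1 ≥ 1 and γ_0 ∈ (0,1] such that for every γ ∈ (0, γ_0] and every ω ∈ ℝ with C_1 γ^{-1/3} ≤ ω ≤ b/(2γ), the quadratic equation z² + γ z + (ω² + a + i b) = 0 has a complex root z ∈ ℂ with Re z > 0. -/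
/-- Instability of modes: there are `C₁ ≥ 1` and `γ₀ ∈ (0,1]` such that for every
`γ ∈ (0,γ₀]` and every `ω` with `C₁ γ^{-1/3} ≤ ω ≤ b/(2γ)`, the characteristic equation
`z² + γz + (ω² + a + ib) = 0` has a root with positive real part. -/
theorem characteristic_root_unstable (a b : ℝ) (hb : 0 < b) :
    ∃ C₁ : ℝ, 1 ≤ C₁ ∧ ∃ γ₀ : ℝ, 0 < γ₀ ∧ γ₀ ≤ 1 ∧
      ∀ γ : ℝ, 0 < γ → γ ≤ γ₀ → ∀ ω : ℝ,
        C₁ * γ ^ (-(1 : ℝ) / 3) ≤ ω → ω ≤ b / (2 * γ) →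
        ∃ z : ℂ, z ^ 2 + (γ : ℂ) * z + ((ω : ℂ) ^ 2 + (a : ℂ) + (b : ℂ) * Complex.I) = 0 ∧
          0 < z.re := by
  have ha : 0 ≤ |a| := abs_nonneg a
  refine ⟨1, le_refl _, min 1 (b / (2 * (|a| + 1))), by positivity, min_le_left _ _, ?_⟩
  intro γ hγ hγ0 ω h1 h2
  have hω : 0 < ω := lt_of_lt_of_le (by positivity) h1
  have hg2 : γ * (2 * (|a| + 1)) ≤ b :=
    (le_div_iff₀ (by positivity)).1 (hγ0.trans (min_le_right _ _))
  have hw : ω * (2 * γ) ≤ b := (le_div_iff₀ (by positivity)).1 h2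
  have e1 : (ω * (2 * γ)) ^ 2 ≤ b ^ 2 := by gcongr
  have e2 : (γ * (2 * (|a| + 1))) ^ 2 ≤ b ^ 2 := by gcongr
  have e3 : γ ^ 2 * a ≤ γ ^ 2 * (|a| + 1) ^ 2 := by
    gcongr
    nlinarith [le_abs_self a]
  have key : γ ^ 2 * (ω ^ 2 + a) < b ^ 2 := by nlinarith [pow_pos hb 2]
  obtain ⟨s, hs, hp⟩ : ∃ s : ℂ, s ^ 2 = (γ : ℂ) ^ 2 / 4
      - ((ω : ℂ) ^ 2 + (a : ℂ) + (b : ℂ) * Complex.I) ∧ 0 ≤ s.re := by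
    obtain ⟨s, hs⟩ := IsAlgClosed.exists_pow_nat_eq ((γ : ℂ) ^ 2 / 4
      - ((ω : ℂ) ^ 2 + (a : ℂ) + (b : ℂ) * Complex.I)) (n := 2) (by norm_num)
    rcases le_total 0 s.re with h | h
    · exact ⟨s, hs, h⟩
    · exact ⟨-s, by rw [neg_sq, hs], by simpa using h⟩
  obtain ⟨p, q⟩ := s
  have hsc : (⟨p, q⟩ : ℂ) ^ 2 = (⟨γ ^ 2 / 4 - (ω ^ 2 + a), -b⟩ : ℂ) := by
    rw [hs]
    have : (⟨γ ^ 2 / 4 - (ω ^ 2 + a), -b⟩ : ℂ)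
        = ((γ ^ 2 / 4 - (ω ^ 2 + a) : ℝ) : ℂ) + ((-b : ℝ) : ℂ) * Complex.I :=
      Complex.mk_eq_add_mul_I _ _
    rw [this]
    push_cast
    ring
  have hre := congrArg Complex.re hsc
  have him := congrArg Complex.im hsc
  simp only [pow_two, Complex.mul_re, Complex.mul_im] at hre him
  simp only at hp
  refine ⟨⟨p, q⟩ - (γ : ℂ) / 2, by linear_combination hs, ?_⟩
  have hlt : γ / 2 < p := by
    by_contra! hle
    have f1 : p ^ 2 ≤ (γ / 2) ^ 2 := by gcongr
    have f2 : q ^ 2 ≤ ω ^ 2 + a := by nlinarith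
    have f3 : b ^ 2 = 4 * (p ^ 2 * q ^ 2) := by
      have : b = -(2 * (p * q)) := by linarith
      rw [this]; ring
    have f4 : p ^ 2 * q ^ 2 ≤ (γ / 2) ^ 2 * (ω ^ 2 + a) := by gcongr
    nlinarith
  have : ((⟨p, q⟩ : ℂ) - (γ : ℂ) / 2).re = p - γ / 2 := by
    simp
  rw [this]
  linarith
end
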